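/- The Σ-induced multi-rb culpability measure m^Σ_{C_#} induced by the counting culpability measure C_# satisfies Multiset Free Formula Independence (IN): for every multiset of rule bases M and every rule r, if r is a free formula of M ∪ {r} then V̂^{m^Σ_{C_#}}(M ∪ {r}) = V̂^{m^Σ_{C_#}}(M). -/

import Mathlib

open scoped Classical

/-- A literal over a set of atoms `A`: an atom or its negation. -/
inductive Literal (A : Type) where
  | pos (a : A)
  | neg (a : A)
deriving DecidableEq

/-- A business rule `l₁,...,lₘ → l₀`: a finite body of literals and a head literal.
A rule with empty body is a fact. -/
structure Rule (A : Type) where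
  body : Finset (Literal A)
  head : Literal A

instance {A : Type} [DecidableEq A] : DecidableEq (Rule A) :=
  fun r s => decidable_of_iff (r.body = s.body ∧ r.head = s.head)
    (by cases r; cases s; simp)

/-- A set of literals `M` is closed w.r.t. a rule base `B` if for every rule of `B`
whose body is contained in `M`, its head is in `M`. -/
def LitsClosed {A : Type} (B : Finset (Rule A)) (M : Set (Literal A)) : Prop :=
  ∀ r ∈ B, (∀ l ∈ r.body, l ∈ M) → r.head ∈ M

/-- The minimal model of a rule base: the smallest closed set of literals. -/
def minModel {A : Type} (B : Finset (Rule A)) : Set (Literal A) :=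
  ⋂₀ {M : Set (Literal A) | LitsClosed B M}

/-- A set of literals is consistent if it contains no atom together with its negation. -/
def ConsistentLits {A : Type} (M : Set (Literal A)) : Prop :=
  ∀ a : A, ¬ (Literal.pos a ∈ M ∧ Literal.neg a ∈ M)

/-- A rule base is consistent if its minimal model is consistent. -/
def RBConsistent {A : Type} (B : Finset (Rule A)) : Prop :=
  ConsistentLits (minModel B)

/-- `MI B`: the minimal inconsistent subsets of `B`. -/
noncomputable def MI {A : Type} [DecidableEq A] (B : Finset (Rule A)) :
    Finset (Finset (Rule A)) :=
  B.powerset.filter fun M => ¬ RBConsistent M ∧ ∀ M' ∈ M.powerset, M' ≠ M → RBConsistent M'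

/-- `F(B)`: the facts (rules with empty body) of a rule base. -/
noncomputable def factsOf {A : Type} (B : Finset (Rule A)) : Finset (Rule A) :=
  B.filter fun r => r.body = ∅

/-- `R(B)`: the non-fact rules of a rule base. -/
noncomputable def rulesOf {A : Type} (B : Finset (Rule A)) : Finset (Rule A) :=
  B.filter fun r => r.body ≠ ∅

/-- The Σ-induced multi-rb culpability measure: a multiset of rule bases is given by a shared
rule set `R` and case-dependent fact sets `F i`, so that `Bᵢ = F i ∪ R`;
then `m^Σ_C(M, r) = Σᵢ C(Bᵢ, r)`. -/
noncomputable def mSigma {A : Type} [DecidableEq A] {n : ℕ}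
    (C : Finset (Rule A) → Rule A → ENNReal)
    (R : Finset (Rule A)) (F : Fin n → Finset (Rule A)) (r : Rule A) : ENNReal :=
  ∑ i : Fin n, C (F i ∪ R) r

/-- `V̂^{C^m}(M) = max_{r ∈ R(M)} C^m(M, r)` for the Σ-induced measure. -/
noncomputable def Vhat {A : Type} [DecidableEq A] {n : ℕ}
    (C : Finset (Rule A) → Rule A → ENNReal)
    (R : Finset (Rule A)) (F : Fin n → Finset (Rule A)) : ENNReal :=
  R.sup fun r => mSigma C R F r

/-- The counting culpability measure `C_#`. -/
noncomputable def Ccount {A : Type} [DecidableEq A] (B : Finset (Rule A)) (r : Rule A) : ENNReal :=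
  (((MI B).filter fun M => r ∈ M).card : ENNReal)

theorem mem_MI {A : Type} [DecidableEq A] {B M : Finset (Rule A)} :
    M ∈ MI B ↔ M ⊆ B ∧ ¬ RBConsistent M ∧ ∀ M' ∈ M.powerset, M' ≠ M → RBConsistent M' := by
  simp only [MI, Finset.mem_filter, Finset.mem_powerset]

theorem MI_eq_of_forall_notMem {A : Type} [DecidableEq A] {B : Finset (Rule A)} {r : Rule A}
    (h : ∀ M ∈ MI (insert r B), r ∉ M) : MI (insert r B) = MI B := by
  ext M
  constructor
  · intro hM
    exact mem_MI.2 ⟨(Finset.subset_insert_iff_of_notMem (h M hM)).1 (mem_MI.1 hM).1,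
      (mem_MI.1 hM).2⟩
  · intro hM
    exact mem_MI.2 ⟨(mem_MI.1 hM).1.trans (Finset.subset_insert r B), (mem_MI.1 hM).2⟩

/-- `m^Σ_{C_#}` satisfies Multiset Free Formula Independence (IN). -/
theorem mSigma_Ccount_multiset_free_formula_independence {A : Type} [DecidableEq A]
    (n : ℕ) (R : Finset (Rule A)) (F : Fin n → Finset (Rule A))
    (hR : ∀ x ∈ R, x.body ≠ ∅) (hF : ∀ i : Fin n, ∀ x ∈ F i, Rule.body x = ∅)
    (r : Rule A) (hr : r.body ≠ ∅)
    (hfree : ∀ i : Fin n, ∀ M ∈ MI (F i ∪ insert r R), r ∉ M) :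
    Vhat Ccount (insert r R) F = Vhat Ccount R F := by
  have hMI : ∀ i, MI (F i ∪ insert r R) = MI (F i ∪ R) := fun i => by
    rw [Finset.union_insert]
    exact MI_eq_of_forall_notMem (by simpa only [Finset.union_insert] using hfree i)
  have hmeasure : ∀ x, mSigma Ccount (insert r R) F x = mSigma Ccount R F x := fun x => by
    simp only [mSigma, Ccount, hMI]
  have hzero : mSigma Ccount (insert r R) F r = 0 := by
    refine Finset.sum_eq_zero fun i _ => ?_
    rw [Ccount, Finset.filter_false_of_mem (hfree i)]
    simp
  rw [Vhat, Finset.sup_insert, hzero, Vhat]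
  simp only [hmeasure]
  exact bot_sup_eq _
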